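/- For every list a ∈ A₁, the list f(a) lies in A₂ and E(f(a)) = E(a). -/

import Mathlib

/-- Continued fraction value of a list of integers (junk value `0` on `[]`,
division by zero yields junk, as usual in Lean). -/
def E : List ℤ → ℚ
  | [] => 0
  | [q] => (q : ℚ)
  | q :: l => (q : ℚ) + 1 / E l

/-- The continued fraction value of the list is well defined: the list is
nonempty and no division by zero occurs in the evaluation of `E`. -/
def EWellDef : List ℤ → Prop
  | [] => False
  | [_] => True
  | _ :: l => EWellDef l ∧ E l ≠ 0

/-- Membership in `A₀`: `[q₀,…,q_r]` with `q_i ≠ 0` for `1 ≤ i ≤ r` and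
`E([q_i,…,q_r]) ≠ 0` for `0 < i < r`. -/
def memA0 (l : List ℤ) : Prop :=
  l ≠ [] ∧ (∀ i, 0 < i → i < l.length → l.getD i 0 ≠ 0) ∧
    ∀ i, 0 < i → i + 1 < l.length → E (l.drop i) ≠ 0

/-- Membership in `A₁`: member of `A₀` with `q_i ≥ 1` for `0 < i < r` and
`q_r > 1` when `r > 0`. -/
def memA1 (l : List ℤ) : Prop :=
  memA0 l ∧ (∀ i, 0 < i → i + 1 < l.length → 1 ≤ l.getD i 0) ∧
    (1 < l.length → 1 < l.getD (l.length - 1) 0)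

/-- Membership in `A₂`: member of `A₀` with `|q_i| > 1` for `0 < i ≤ r`. -/
def memA2 (l : List ℤ) : Prop :=
  memA0 l ∧ ∀ i, 0 < i → i < l.length → 1 < |l.getD i 0|

/-- Euclidean-algorithm computation of the short continued fraction of `a/b`. -/
def scfAux (a : ℤ) (b : ℕ) : List ℤ :=
  if hb : b = 0 then []
  else
    have h0 : 0 ≤ Int.emod a (b : ℤ) := Int.emod_nonneg a (by exact_mod_cast hb)
    have h1 : Int.emod a (b : ℤ) < (b : ℤ) :=
      Int.emod_lt_of_pos a (by exact_mod_cast Nat.pos_of_ne_zero hb)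
    if hr : (Int.emod a (b : ℤ)).toNat = 0 then [Int.ediv a (b : ℤ)]
    else Int.ediv a (b : ℤ) :: scfAux (b : ℤ) (Int.emod a (b : ℤ)).toNat
  termination_by b
  decreasing_by omega

/-- `C x` is the short continued fraction representation of the rational `x`,
i.e. the unique list in `A₁` whose continued fraction value is `x`. -/
def C (x : ℚ) : List ℤ := scfAux x.num x.den

/-- Entrywise negation of a list. -/
def negL (l : List ℤ) : List ℤ := l.map (fun q => -q)

/-- The operation `⊕` on lists. -/
def oplus (a b : List ℤ) : List ℤ :=
  match b with
  | [] => a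
  | p :: ps =>
    if p = 0 then a.dropLast ++ (a.getLastD 0 + ps.headD 0) :: ps.tail
    else a ++ (p :: ps)

/-- The function `f : A₁ → A₂`. -/
def f (l : List ℤ) : List ℤ :=
  if h : (l.tail.dropLast).findIdx (fun q => q == 1) < l.tail.dropLast.length then
    let j := (l.tail.dropLast).findIdx (fun q => q == 1) + 1
    oplus (l.take (j - 1) ++ [l.getD (j - 1) 0 + 1])
      (negL (f ((l.getD (j + 1) 0 + 1) :: l.drop (j + 2))))
  else l
  termination_by l.length
  decreasing_by
    simp only [List.length_dropLast, List.length_tail, List.length_cons,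
      List.length_drop] at h ⊢
    omega

/-- The function `g : A₂ → A₁`. -/
def g (l : List ℤ) : List ℤ :=
  if h : (l.tail).findIdx (fun q => decide (q < 0)) < l.tail.length then
    let j := (l.tail).findIdx (fun q => decide (q < 0)) + 1
    oplus (l.take (j - 1) ++ [l.getD (j - 1) 0 - 1, 1])
      (g (negL ((l.getD j 0 + 1) :: l.drop (j + 1))))
  else l
  termination_by l.length
  decreasing_by
    simp only [negL, List.length_map, List.length_cons, List.length_drop,
      List.length_tail] at h ⊢
    omega

/-- `[q₀,…,q_r]` satisfies the `(u,v)`-divisibility property: `v ∣ q_i` for even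
`i` and `u ∣ q_i` for odd `i`. -/
def DivProp (u v : ℤ) (l : List ℤ) : Prop :=
  ∀ i, i < l.length → (i % 2 = 0 → v ∣ l.getD i 0) ∧ (i % 2 = 1 → u ∣ l.getD i 0)


theorem E_cons (q : ℤ) (l : List ℤ) : E (q :: l) = q + 1 / E l := by
  cases l <;> simp [E]

theorem E_negL (l : List ℤ) : E (negL l) = -E l := by
  induction l with
  | nil => simp [negL, E]
  | cons q l ih =>
    have h : negL (q :: l) = -q :: negL l := rfl
    rw [h, E_cons, E_cons, ih, one_div, one_div, inv_neg]
    push_cast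
    ring

theorem E_cons_pos (q : ℤ) (l : List ℤ) (h : ∀ x ∈ q :: l, 1 ≤ x) : 0 < E (q :: l) := by
  induction l generalizing q with
  | nil =>
    have hq : 1 ≤ q := h q (by simp)
    simp only [E]
    exact_mod_cast hq
  | cons p l ih =>
    have hq : (1 : ℚ) ≤ q := by exact_mod_cast h q (by simp)
    have hp := one_div_pos.2 (ih p fun x hx => h x (List.mem_cons_of_mem _ hx))
    rw [E_cons]
    linarith

/-- The value of a continued fraction whose terms all have absolute value at least two has
absolute value greater than one. -/
theorem one_lt_abs_E_cons (q : ℤ) (l : List ℤ) (h : ∀ x ∈ q :: l, 1 < |x|) :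
    1 < |E (q :: l)| := by
  induction l generalizing q with
  | nil =>
    simp only [E]
    exact_mod_cast h q (by simp)
  | cons p l ih =>
    have hq : (2 : ℚ) ≤ |(q : ℚ)| := by exact_mod_cast h q (by simp)
    have hp := ih p fun x hx => h x (List.mem_cons_of_mem _ hx)
    have hinv : |1 / E (p :: l)| < 1 := by
      rw [abs_div, abs_one, div_lt_one (by linarith)]
      exact hp
    have habs := abs_sub_abs_le_abs_sub (q : ℚ) (-(1 / E (p :: l)))
    rw [abs_neg, sub_neg_eq_add] at habs
    rw [E_cons]
    linarith

theorem memA2_cons (q : ℤ) (l : List ℤ) (h : ∀ x ∈ l, 1 < |x|) : memA2 (q :: l) := by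
  have hmem : ∀ i, 0 < i → i < (q :: l).length → 1 < |(q :: l).getD i 0| := by
    intro i hi hil
    obtain ⟨k, rfl⟩ := Nat.exists_eq_succ_of_ne_zero hi.ne'
    have hk : k < l.length := by simpa using hil
    simpa [hk] using h _ (List.getElem_mem hk)
  refine ⟨⟨by simp, fun i hi hil h0 => ?_, fun i hi hil h0 => ?_⟩, hmem⟩
  · have := hmem i hi hil
    rw [h0] at this
    norm_num at this
  · obtain ⟨k, rfl⟩ := Nat.exists_eq_succ_of_ne_zero hi.ne'
    rw [List.drop_succ_cons] at h0
    have hk : k < l.length := by simp at hil; omega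
    rw [List.drop_eq_getElem_cons hk] at h0
    have := one_lt_abs_E_cons l[k] (l.drop (k + 1)) fun x hx => h x <| by
      rw [← List.drop_eq_getElem_cons hk] at hx
      exact List.mem_of_mem_drop hx
    rw [h0] at this
    norm_num at this

theorem oplus_cons_left (q : ℤ) {a : List ℤ} (ha : a ≠ []) (b : List ℤ) :
    oplus (q :: a) b = q :: oplus a b := by
  obtain ⟨p, a, rfl⟩ := List.exists_cons_of_ne_nil ha
  cases b with
  | nil => rfl
  | cons r b =>
    simp only [oplus]
    split_ifs <;> simp

theorem f_singleton (a : ℤ) : f [a] = [a] := by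
  rw [f]; simp

theorem f_pair (a b : ℤ) : f [a, b] = [a, b] := by
  rw [f]; simp

theorem f_cons_one_cons (a c : ℤ) (t : List ℤ) :
    f (a :: 1 :: c :: t) = oplus [a + 1] (negL (f ((c + 1) :: t))) := by
  rw [f]; simp [List.findIdx_cons]

theorem f_cons_of_ne_one (a : ℤ) {b : ℤ} (hb : b ≠ 1) (c : ℤ) (t : List ℤ) :
    f (a :: b :: c :: t) = a :: f (b :: c :: t) := by
  rw [f, f]
  have hidx : (a :: b :: c :: t).tail.dropLast.findIdx (fun q => q == 1) =
      (b :: c :: t).tail.dropLast.findIdx (fun q => q == 1) + 1 := by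
    simp [List.findIdx_cons, beq_eq_false_iff_ne.2 hb]
  have hlen : (a :: b :: c :: t).tail.dropLast.length =
      (b :: c :: t).tail.dropLast.length + 1 := by simp
  simp only [hidx, hlen, add_lt_add_iff_right]
  split_ifs
  · rw [← oplus_cons_left a (by simp)]
    simp
  · rfl

/-- On `A₁`, `f` does not decrease the first term, makes all later terms at least two in absolute
value, and preserves the value of the continued fraction. -/
theorem exists_f_cons_eq (a : ℤ) (t : List ℤ) (hpos : ∀ x ∈ t, 1 ≤ x)
    (hlast : ∀ x ∈ t.getLast?, 1 < x) :
    ∃ h s, f (a :: t) = h :: s ∧ a ≤ h ∧ (∀ x ∈ s, 1 < |x|) ∧ E (h :: s) = E (a :: t) := by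
  match t with
  | [] => exact ⟨a, [], f_singleton a, le_rfl, by simp, rfl⟩
  | [b] =>
    refine ⟨a, [b], f_pair a b, le_rfl, fun x hx => ?_, rfl⟩
    obtain rfl := List.mem_singleton.1 hx
    exact (hlast x (by simp)).trans_le (le_abs_self x)
  | b :: c :: t =>
    have hposc : ∀ x ∈ c :: t, 1 ≤ x := fun x hx => hpos x (List.mem_cons_of_mem _ hx)
    have hlastc : ∀ x ∈ (c :: t).getLast?, 1 < x := by simpa using hlast
    by_cases hb : b = 1
    · subst hb
      have hlastt : ∀ x ∈ t.getLast?, 1 < x := by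
        cases t with
        | nil => simp
        | cons d t => simpa using hlastc
      obtain ⟨h, s, hf, hle, hs, hE⟩ := exists_f_cons_eq (c + 1) t
        (fun x hx => hposc x (List.mem_cons_of_mem _ hx)) hlastt
      have hc : 1 ≤ c := hposc c (by simp)
      have hneg : negL (h :: s) = -h :: negL s := rfl
      refine ⟨a + 1, negL (h :: s), ?_, by omega, ?_, ?_⟩
      · rw [f_cons_one_cons, hf, hneg, oplus, if_neg (by omega)]
        rfl
      · intro x hx
        obtain ⟨y, hy, rfl⟩ := List.mem_map.1 hx
        rw [abs_neg]
        rcases List.mem_cons.1 hy with rfl | hy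
        · exact lt_of_lt_of_le (by omega) (le_abs_self y)
        · exact hs y hy
      · have hx := E_cons_pos c t hposc
        have hshift : E ((c + 1) :: t) = E (c :: t) + 1 := by
          rw [E_cons, E_cons]; push_cast; ring
        rw [E_cons, E_negL, hE, hshift, E_cons a, E_cons 1]
        push_cast
        have h1 : E (c :: t) + 1 ≠ 0 := by positivity
        have h2 : 1 + 1 / E (c :: t) ≠ 0 := by positivity
        field_simp
        ring
    · have hb1 : 1 ≤ b := hpos b (by simp)
      obtain ⟨h, s, hf, hle, hs, hE⟩ := exists_f_cons_eq b (c :: t) hposc hlastc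
      refine ⟨a, h :: s, ?_, le_rfl, ?_, ?_⟩
      · rw [f_cons_of_ne_one a hb, hf]
      · intro x hx
        rcases List.mem_cons.1 hx with rfl | hx
        · exact lt_of_lt_of_le (by omega) (le_abs_self x)
        · exact hs x hx
      · rw [E_cons, hE, ← E_cons]
  termination_by t.length

/-- for every list `a ∈ A₁`, the list `f(a)` lies in `A₂` and
`E(f(a)) = E(a)`. -/
theorem f_mem_A2_and_E_eq (l : List ℤ) (hl : memA1 l) :
    memA2 (f l) ∧ E (f l) = E l := by
  obtain ⟨⟨hne, -, -⟩, hpos, hlast⟩ := hl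
  obtain ⟨a, t, rfl⟩ := List.exists_cons_of_ne_nil hne
  have hlast' : ∀ x ∈ t.getLast?, 1 < x := by
    intro x hx
    have ht : t ≠ [] := by rintro rfl; simp at hx
    have hlen := List.length_pos_iff.2 ht
    have := hlast (by simpa using hlen)
    rw [List.getLast?_eq_getElem?] at hx
    obtain ⟨k, hk⟩ := Nat.exists_eq_succ_of_ne_zero hlen.ne'
    simp_all
  have hpos' : ∀ x ∈ t, 1 ≤ x := by
    intro x hx
    obtain ⟨k, hk, rfl⟩ := List.mem_iff_getElem.1 hx
    rcases Nat.lt_or_ge (k + 1) t.length with h | h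
    · simpa [hk] using hpos (k + 1) (by omega) (by simpa using h)
    · refine (hlast' _ ?_).le
      rw [List.getLast?_eq_getElem?, show t.length - 1 = k by omega]
      simp [hk]
  obtain ⟨h, s, hf, -, hs, hE⟩ := exists_f_cons_eq a t hpos' hlast'
  rw [hf]
  exact ⟨memA2_cons h s hs, hE⟩
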